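/- arXiv:2501.17136 — 2 statements merged into one kernel-verified Lean document; each statement's English description precedes it below -/
import Mathlib

section
/- Let k ≥ 3 and let a_1, …, a_k be nonzero integers such that the equation E : a_1x_1 + ⋯ + a_kx_k = 0 is 2-uncommon over the integers, i.e., there exist δ > 0 and N₀ such that for every n ≥ N₀ there is a coloring c : {1,…,n} → {1,2} with 2^{k−1} · #{monochromatic solutions of E in {1,…,n}^k} ≤ (1 − δ) · #{solutions of E in {1,…,n}^k}. Then for every integer r ≥ 3 the equation E is r-uncommon over the integers: there exist δ' > 0 and N₁ such that for every n ≥ N₁ there is a coloring c : {1,…,n} → {1,…,r} with r^{k−1} · #{monochromatic solutions of E in {1,…,n}^k} ≤ (1 − δ') · #{solutions of E in {1,…,n}^k}. -/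
open Finset in
/-- The number of functions sending the range of an injective family into a prescribed set. -/
theorem card_filter_forall_mem_mul {V β : Type*} [Fintype V] [DecidableEq V] [Fintype β]
    [DecidableEq β] {k : ℕ} (x : Fin k → V) (hx : Function.Injective x) (A : Finset β) :
    #{ω : V → β | ∀ i, ω (x i) ∈ A} * Fintype.card β ^ k =
      #A ^ k * Fintype.card β ^ Fintype.card V := by
  have h : ({ω : V → β | ∀ i, ω (x i) ∈ A} : Finset (V → β)) =
      Fintype.piFinset fun v => if v ∈ univ.image x then A else univ := by
    ext ω
    simp only [mem_filter, mem_univ, true_and, Fintype.mem_piFinset]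
    constructor
    · intro h v
      split_ifs with hv
      · obtain ⟨i, -, rfl⟩ := mem_image.1 hv
        exact h i
      · exact mem_univ _
    · intro h i
      simpa using h (x i)
  have himage : #{v | v ∈ univ.image x} = k := by
    rw [filter_univ_mem, card_image_of_injective _ hx, card_univ, Fintype.card_fin]
  have hcompl : k + #{v | v ∉ univ.image x} = Fintype.card V := by
    have := card_filter_add_card_filter_not (s := univ) (fun v => v ∈ univ.image x)
    rwa [himage, card_univ] at this
  rw [h, Fintype.card_piFinset]
  simp only [apply_ite card, prod_ite, prod_const, card_univ]
  rw [himage, mul_assoc, ← pow_add, add_comm _ k, hcompl]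

/-- Keep the color `b` when `j` is one of the first two colors, and use `j` otherwise. -/
def mixColor {m : ℕ} (b : Fin 2) (j : Fin (m + 2)) : Fin (m + 2) :=
  if j.val < 2 then Fin.castLE (Nat.le_add_left 2 m) b else j

theorem mixColor_val_lt_two_iff {m : ℕ} (b : Fin 2) (j : Fin (m + 2)) :
    (mixColor b j).val < 2 ↔ j.val < 2 := by
  unfold mixColor
  split_ifs with h
  · simp only [Fin.val_castLE, b.isLt, h]
  · rfl

open Finset in
/-- Bound on the number of random assignments for which an injective family is monochromatic. -/
theorem card_filter_mixColor_mono_le {V : Type*} [Fintype V] [DecidableEq V] {k : ℕ}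
    [NeZero k] (m : ℕ) (x : Fin k → V) (hx : Function.Injective x) (c : V → Fin 2) :
    (m + 2) ^ k * #{ω : V → Fin (m + 2) | ∀ i j,
      mixColor (c (x i)) (ω (x i)) = mixColor (c (x j)) (ω (x j))} ≤
    ((if ∀ i j, c (x i) = c (x j) then 2 ^ k else 0) + m) *
      (m + 2) ^ Fintype.card V := by
  classical
  set low : Finset (Fin (m + 2)) := {j | j.val < 2} with hlow
  set high : Finset (Fin (m + 2)) := {j | ¬ j.val < 2} with hhigh
  have hlow_card : #low = 2 := by
    have : low = {0, 1} := by
      ext j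
      simp only [hlow, mem_filter, mem_univ, true_and, mem_insert, mem_singleton, Fin.ext_iff,
        Fin.val_zero, Fin.val_one]
      omega
    rw [this, card_pair (by simp)]
  have hhigh_card : #high = m := by
    have := card_filter_add_card_filter_not (s := (univ : Finset (Fin (m + 2))))
      (fun j => j.val < 2)
    rw [← hlow, ← hhigh, hlow_card, card_univ, Fintype.card_fin] at this
    omega
  have hsub : ({ω : V → Fin (m + 2) | ∀ i j,
      mixColor (c (x i)) (ω (x i)) = mixColor (c (x j)) (ω (x j))} : Finset _) ⊆
      (if ∀ i j, c (x i) = c (x j) then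
          ({ω : V → Fin (m + 2) | ∀ i, ω (x i) ∈ low} : Finset _) else ∅) ∪
        high.biUnion fun j => {ω : V → Fin (m + 2) | ∀ i, ω (x i) ∈ ({j} : Finset _)} := by
    intro ω hω
    simp only [mem_filter, mem_univ, true_and] at hω
    by_cases h0 : (ω (x 0)).val < 2
    · have hall : ∀ i, (ω (x i)).val < 2 := fun i => by
        rw [← mixColor_val_lt_two_iff (c (x i)), hω i 0, mixColor_val_lt_two_iff]
        exact h0
      have hc : ∀ i j, c (x i) = c (x j) := fun i j => by
        have := hω i j
        simpa [mixColor, hall i, hall j] using this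
      rw [if_pos hc]
      exact mem_union_left _ (by simpa only [hlow, mem_filter, mem_univ, true_and] using hall)
    · have hall : ∀ i, ¬ (ω (x i)).val < 2 := fun i => by
        rw [← mixColor_val_lt_two_iff (c (x i)), hω i 0, mixColor_val_lt_two_iff]
        exact h0
      refine mem_union_right _ (mem_biUnion.2 ⟨ω (x 0), by simpa [hhigh] using h0, ?_⟩)
      simp only [mem_filter, mem_univ, true_and, mem_singleton]
      intro i
      have := hω i 0
      rwa [mixColor, mixColor, if_neg (hall i), if_neg h0] at this
  have hcount := card_filter_forall_mem_mul (β := Fin (m + 2)) x hx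
  simp only [Fintype.card_fin] at hcount
  calc _ ≤ (m + 2) ^ k *
        (#(if ∀ i j, c (x i) = c (x j) then
            ({ω : V → Fin (m + 2) | ∀ i, ω (x i) ∈ low} : Finset _) else ∅) +
          ∑ j ∈ high, #{ω : V → Fin (m + 2) | ∀ i, ω (x i) ∈ ({j} : Finset _)}) := by
        gcongr
        exact (card_le_card hsub).trans ((card_union_le _ _).trans
          (Nat.add_le_add_left card_biUnion_le _))
    _ = _ := by
        rw [mul_add, mul_sum, add_mul]
        congr 1
        · split_ifs
          · rw [mul_comm, hcount, hlow_card]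
          · simp
        · simp only [mul_comm ((m + 2) ^ k), hcount, card_singleton, one_pow,
            one_mul, sum_const, hhigh_card, smul_eq_mul]

open Finset in
/-- From a `2`-coloring one obtains an `(m + 2)`-coloring whose number of monochromatic members
of a finite family is controlled, up to the members with repeated entries. -/
theorem exists_coloring_card_mono_le {α : Type*} [DecidableEq α] {k : ℕ} [NeZero k] (m : ℕ)
    (S : Finset α) (F : Finset (Fin k → α)) (hF : ∀ x ∈ F, ∀ i, x i ∈ S) (c : α → Fin 2) :
    ∃ c' : α → Fin (m + 2),
      (m + 2) ^ k * #{x ∈ F | ∀ i j, c' (x i) = c' (x j)} ≤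
        2 ^ k * #{x ∈ F | ∀ i j, c (x i) = c (x j)} + m * #F +
          (m + 2) ^ k * #{x ∈ F | ¬ Function.Injective x} := by
  classical
  let col (ω : S → Fin (m + 2)) (a : α) : Fin (m + 2) :=
    if h : a ∈ S then mixColor (c a) (ω ⟨a, h⟩) else 0
  have hx : ∀ x ∈ F, (m + 2) ^ k * #{ω | ∀ i j, col ω (x i) = col ω (x j)} ≤
      (2 ^ k * (if ∀ i j, c (x i) = c (x j) then 1 else 0) + m +
        (m + 2) ^ k * (if ¬ Function.Injective x then 1 else 0)) *
          (m + 2) ^ Fintype.card S := by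
    intro x hxF
    by_cases hinj : Function.Injective x
    · let y : Fin k → S := fun i => ⟨x i, hF x hxF i⟩
      have hy : Function.Injective y := fun i j h => hinj (congrArg Subtype.val h)
      have := card_filter_mixColor_mono_le m y hy (fun v => c v)
      have hcol : ∀ ω i, col ω (x i) = mixColor (c (y i)) (ω (y i)) := fun ω i => by
        simp [col, y, hF x hxF i]
      simp only [hcol]
      refine this.trans (Nat.mul_le_mul_right _ ?_)
      simp [hinj, y]
    · have hle : #{ω | ∀ i j, col ω (x i) = col ω (x j)} ≤ (m + 2) ^ Fintype.card S := by
        refine (card_le_univ _).trans ?_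
        simp
      refine (Nat.mul_le_mul_left _ hle).trans (Nat.mul_le_mul_right _ ?_)
      simp [hinj]
  have hsum : ∑ ω : S → Fin (m + 2),
        (m + 2) ^ k * #{x ∈ F | ∀ i j, col ω (x i) = col ω (x j)} ≤
      ∑ _ω : S → Fin (m + 2), (2 ^ k * #{x ∈ F | ∀ i j, c (x i) = c (x j)} + m * #F +
          (m + 2) ^ k * #{x ∈ F | ¬ Function.Injective x}) := by
    calc _ = ∑ x ∈ F, (m + 2) ^ k * #{ω | ∀ i j, col ω (x i) = col ω (x j)} := by
          simp only [card_filter, mul_sum]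
          rw [sum_comm]
      _ ≤ _ := sum_le_sum hx
      _ = _ := by
          rw [← sum_mul, sum_add_distrib, sum_add_distrib, ← mul_sum, ← mul_sum,
            ← card_filter, ← card_filter]
          simp only [sum_const, smul_eq_mul, card_univ, Fintype.card_fun, Fintype.card_fin]
          ring
  obtain ⟨ω, -, hω⟩ := exists_le_of_sum_le univ_nonempty hsum
  exact ⟨col ω, hω⟩

open Finset in
/-- A nontrivial linear equation in at least three variables has few solutions with two prescribed
entries equal. -/
theorem card_solutions_eq_le {k : ℕ} (hk : 3 ≤ k) (a : Fin k → ℤ) (ha : ∀ i, a i ≠ 0) (n : ℕ)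
    {i j : Fin k} (hij : i ≠ j) :
    #{x ∈ Fintype.piFinset fun _ : Fin k => Icc (1 : ℤ) n |
      ∑ i, a i * x i = 0 ∧ x i = x j} ≤ n ^ (k - 2) := by
  obtain ⟨l, hlj, hl⟩ : ∃ l, l ≠ j ∧ ∀ d : Fin k → ℤ, ∑ i, a i * d i = 0 → d i = d j →
      (∀ p, p ≠ j → p ≠ l → d p = 0) → d = 0 := by
    by_cases hs : a i + a j = 0
    · obtain ⟨l, hl⟩ : ∃ l, l ∉ ({i, j} : Finset (Fin k)) := by
        by_contra! h
        have := card_le_card (fun x _ => h x : (univ : Finset (Fin k)) ⊆ {i, j})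
        rw [card_univ, Fintype.card_fin, card_pair hij] at this
        omega
      simp only [mem_insert, mem_singleton, not_or] at hl
      refine ⟨l, hl.2, fun d hd hdij h => ?_⟩
      have hi : d i = 0 := h i hij (Ne.symm hl.1)
      have hj : d j = 0 := hdij ▸ hi
      rw [sum_eq_single l (fun p _ hp => by
        by_cases hpj : p = j
        · simp [hpj, hj]
        · simp [h p hpj hp]) (by simp)] at hd
      have hl0 : d l = 0 := (mul_eq_zero.1 hd).resolve_left (ha l)
      funext p
      by_cases hpj : p = j
      · simp [hpj, hj]
      by_cases hpl : p = l
      · simp [hpl, hl0]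
      exact h p hpj hpl
    · refine ⟨i, hij, fun d hd hdij h => ?_⟩
      have hsub : ∑ p ∈ ({i, j} : Finset (Fin k)), a p * d p = ∑ p, a p * d p :=
        sum_subset (subset_univ _) fun p _ hp => by
          simp only [mem_insert, mem_singleton, not_or] at hp
          simp [h p hp.2 hp.1]
      rw [hd, sum_pair hij, ← hdij, ← add_mul] at hsub
      have hi : d i = 0 := (mul_eq_zero.1 hsub).resolve_left hs
      have hj : d j = 0 := hdij ▸ hi
      funext p
      by_cases hpj : p = j
      · simp [hpj, hj]
      by_cases hpi : p = i
      · simp [hpi, hi]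
      exact h p hpj hpi
  have hcard : #(Fintype.piFinset fun _ : {p : Fin k // p ∉ ({j, l} : Finset (Fin k))} =>
      Icc (1 : ℤ) n) = n ^ (k - 2) := by
    rw [Fintype.card_piFinset, prod_const, card_univ, Fintype.card_subtype_compl,
      Fintype.card_coe, card_pair (Ne.symm hlj), Fintype.card_fin, Int.card_Icc]
    simp
  rw [← hcard]
  refine card_le_card_of_injOn (fun x p => x p) ?_ ?_
  · intro x hx
    simp only [coe_filter, Fintype.mem_piFinset, Set.mem_ofPred_eq] at hx
    simp only [Fintype.coe_piFinset, Set.mem_pi]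
    exact fun p _ => hx.1 p
  · intro x hx y hy hxy
    simp only [coe_filter, Set.mem_ofPred_eq] at hx hy
    have := hl (x - y) (by simp [mul_sub, hx.2.1, hy.2.1]) (by simp [hx.2.2, hy.2.2])
      (fun p hpj hpl => by
        have := congrFun hxy ⟨p, by simp [hpj, hpl]⟩
        simpa [sub_eq_zero] using this)
    exact sub_eq_zero.1 this

open Finset in
/-- A nontrivial linear equation in at least three variables has few solutions with repeated
entries. -/
theorem card_noninjective_solutions_le {k : ℕ} (hk : 3 ≤ k) (a : Fin k → ℤ)
    (ha : ∀ i, a i ≠ 0) (n : ℕ) :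
    #{x ∈ {x ∈ Fintype.piFinset fun _ : Fin k => Icc (1 : ℤ) n | ∑ i, a i * x i = 0} |
      ¬ Function.Injective x} ≤ k ^ 2 * n ^ (k - 2) := by
  have hsub : ({x ∈ {x ∈ Fintype.piFinset fun _ : Fin k => Icc (1 : ℤ) n | ∑ i, a i * x i = 0} |
      ¬ Function.Injective x} : Finset _) ⊆
      (univ.filter fun p : Fin k × Fin k => p.1 ≠ p.2).biUnion fun p =>
        {x ∈ Fintype.piFinset fun _ : Fin k => Icc (1 : ℤ) n |
          ∑ i, a i * x i = 0 ∧ x p.1 = x p.2} := by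
    intro x hx
    simp only [mem_filter] at hx
    obtain ⟨⟨hbox, hsol⟩, hinj⟩ := hx
    rw [Function.Injective] at hinj
    push Not at hinj
    obtain ⟨i, j, hxij, hij⟩ := hinj
    exact mem_biUnion.2 ⟨(i, j), by simpa using hij, by
      simp only [mem_filter]
      exact ⟨hbox, hsol, hxij⟩⟩
  refine (card_le_card hsub).trans ((card_biUnion_le_card_mul _ _ (n ^ (k - 2)) ?_).trans ?_)
  · intro p hp
    exact card_solutions_eq_le hk a ha n (by simpa using hp)
  · gcongr
    refine (card_le_univ _).trans ?_
    simp [sq]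

open Finset in
/-- A linear equation with coefficients of both signs has a positive solution. -/
theorem exists_positive_solution {k : ℕ} (a : Fin k → ℤ) {p q : Fin k} (hp : 0 < a p)
    (hq : a q < 0) :
    ∃ y : Fin k → ℤ, ∑ i, a i * y i = 0 ∧ ∀ i, 1 ≤ y i ∧ y i ≤ ∑ j, |a j| := by
  set P := ∑ j, max (a j) 0 with hP
  set Q := ∑ j, max (-a j) 0 with hQ
  have hP1 : a p ≤ P := (le_max_left _ _).trans
    (single_le_sum (f := fun j => max (a j) 0) (fun j _ => le_max_right _ _) (mem_univ p))
  have hQ1 : -a q ≤ Q := (le_max_left _ _).trans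
    (single_le_sum (f := fun j => max (-a j) 0) (fun j _ => le_max_right _ _) (mem_univ q))
  have hPA : P ≤ ∑ j, |a j| := sum_le_sum fun j _ => max_le (le_abs_self _) (abs_nonneg _)
  have hQA : Q ≤ ∑ j, |a j| := sum_le_sum fun j _ => max_le (neg_le_abs _) (abs_nonneg _)
  refine ⟨fun i => if 0 < a i then Q else P, ?_, fun i => ?_⟩
  · have : ∀ i, a i * (if 0 < a i then Q else P) = max (a i) 0 * Q - max (-a i) 0 * P := by
      intro i
      split_ifs with h
      · rw [max_eq_left h.le, max_eq_right (by omega)]; ring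
      · rw [max_eq_right (by omega), max_eq_left (by omega)]; ring
    simp only [this, sum_sub_distrib, ← sum_mul, ← hP, ← hQ]
    ring
  · dsimp only
    split_ifs <;> omega

open Finset in
/-- A linear equation with coefficients of both signs has many solutions. -/
theorem pow_le_card_solutions {k : ℕ} (a : Fin k → ℤ) {p q : Fin k}
    (hp : 0 < a p) (hq : a q < 0) {n s : ℕ}
    (hn : ((∑ j, |a j|) + 1) ^ 2 * ((s : ℤ) + 1) ≤ n) :
    (s + 1) ^ (k - 1) ≤
      #{x ∈ Fintype.piFinset fun _ : Fin k => Icc (1 : ℤ) n | ∑ i, a i * x i = 0} := by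
  obtain ⟨y, hy, hyb⟩ := exists_positive_solution a hp hq
  set A := ∑ j, |a j| with hA
  have hA0 : 0 ≤ A := sum_nonneg fun j _ => abs_nonneg _
  have hcard : #(Fintype.piFinset fun l : Fin k => if l = p then {0} else Icc (0 : ℤ) s) =
      (s + 1) ^ (k - 1) := by
    rw [Fintype.card_piFinset]
    have hcast : ((s : ℤ) + 1 - 0).toNat = s + 1 := by omega
    simp only [apply_ite card, card_singleton, Int.card_Icc, hcast]
    rw [prod_ite, prod_const_one, one_mul, prod_const, filter_ne' univ p,
      card_erase_of_mem (mem_univ p), card_univ, Fintype.card_fin]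
  rw [← hcard]
  refine card_le_card_of_injOn (fun z l => (A * s + 1) * y l +
    (a p * z l - if l = p then ∑ i, a i * z i else 0)) ?_ ?_
  · intro z hz
    simp only [Fintype.coe_piFinset, Set.mem_pi, Set.mem_univ, true_implies] at hz
    have hzp : z p = 0 := by simpa using hz p
    have hzb : ∀ l, 0 ≤ z l ∧ z l ≤ s := fun l => by
      by_cases hl : l = p
      · subst hl; simp [hzp]
      · simpa [hl] using hz l
    have habs : ∀ l, |a l * z l| ≤ |a l| * s := fun l => by
      rw [abs_mul, abs_of_nonneg (hzb l).1]
      exact mul_le_mul_of_nonneg_left (hzb l).2 (abs_nonneg _)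
    have hdev : ∀ l, |a p * z l - if l = p then ∑ i, a i * z i else 0| ≤ A * s := fun l => by
      by_cases hl : l = p
      · subst hl
        simp only [hzp, mul_zero, if_true, zero_sub, abs_neg]
        refine (abs_sum_le_sum_abs _ _).trans ?_
        rw [hA, sum_mul]
        exact sum_le_sum fun l _ => habs l
      · rw [if_neg hl, sub_zero, abs_mul, abs_of_nonneg (hzb l).1]
        exact mul_le_mul (single_le_sum (f := fun j => |a j|) (fun j _ => abs_nonneg _)
          (mem_univ p)) (hzb l).2 (hzb l).1 hA0
    simp only [coe_filter, Fintype.mem_piFinset, mem_Icc, Set.mem_ofPred_eq]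
    refine ⟨fun l => ?_, ?_⟩
    · have hd := abs_le.1 (hdev l)
      have hs : 0 ≤ A * s := by positivity
      have h1 := mul_le_mul_of_nonneg_left (hyb l).1 (by omega : 0 ≤ A * s + 1)
      have h2 := mul_le_mul_of_nonneg_left (hyb l).2 (by omega : 0 ≤ A * s + 1)
      have hs' : (0 : ℤ) ≤ s := by positivity
      constructor <;> nlinarith
    · simp only [mul_add, mul_sub, sum_add_distrib, sum_sub_distrib, mul_ite, mul_zero,
        sum_ite_eq', mem_univ, if_true]
      have h1 : ∑ l, a l * ((A * s + 1) * y l) = (A * s + 1) * ∑ l, a l * y l := by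
        rw [mul_sum]
        exact sum_congr rfl fun l _ => by ring
      have h2 : ∑ l, a l * (a p * z l) = a p * ∑ l, a l * z l := by
        rw [mul_sum]
        exact sum_congr rfl fun l _ => by ring
      rw [h1, h2, hy]
      ring
  · intro z hz w hw hzw
    simp only [Fintype.coe_piFinset, Set.mem_pi, Set.mem_univ, true_implies] at hz hw
    funext l
    by_cases hl : l = p
    · subst hl
      have h1 : z l = 0 := by simpa using hz l
      have h2 : w l = 0 := by simpa using hw l
      rw [h1, h2]
    · have := congrFun hzw l
      simpa [hl, hp.ne'] using this

open Finset in
/-- A linear equation whose coefficients all have the same sign has no positive solutions. -/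
theorem solutions_eq_empty {k : ℕ} (hk : 0 < k) (a : Fin k → ℤ) (ha : ∀ i, a i ≠ 0)
    (hsign : ¬ ((∃ p, 0 < a p) ∧ ∃ q, a q < 0)) (n : ℕ) :
    ({x ∈ Fintype.piFinset fun _ : Fin k => Icc (1 : ℤ) n | ∑ i, a i * x i = 0} : Finset _) =
      ∅ := by
  have : Nonempty (Fin k) := ⟨⟨0, hk⟩⟩
  refine filter_eq_empty_iff.2 fun x hx => ?_
  simp only [Fintype.mem_piFinset, mem_Icc] at hx
  by_cases hpos : ∃ p, 0 < a p
  · have hall : ∀ q, 0 < a q := fun q => by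
      have : ¬ a q < 0 := fun h => hsign ⟨hpos, q, h⟩
      have := ha q
      omega
    exact (sum_pos (fun i _ => mul_pos (hall i) (by linarith [(hx i).1])) univ_nonempty).ne'
  · push Not at hpos
    exact (sum_neg (fun i _ => mul_neg_of_neg_of_pos (lt_of_le_of_ne (hpos i) (ha i))
      (by linarith [(hx i).1])) univ_nonempty).ne

open Finset in
/-- For an equation with coefficients of both signs, the solutions with repeated entries form
a negligible proportion of all solutions. -/
theorem exists_forall_card_noninjective_le {k : ℕ} (hk : 3 ≤ k) (a : Fin k → ℤ)
    (ha : ∀ i, a i ≠ 0) {p q : Fin k} (hp : 0 < a p) (hq : a q < 0) {ε : ℝ} (hε : 0 < ε) :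
    ∃ N : ℕ, ∀ n : ℕ, N ≤ n →
      (#{x ∈ {x ∈ Fintype.piFinset fun _ : Fin k => Icc (1 : ℤ) n | ∑ i, a i * x i = 0} |
        ¬ Function.Injective x} : ℝ) ≤
      ε * #{x ∈ Fintype.piFinset fun _ : Fin k => Icc (1 : ℤ) n | ∑ i, a i * x i = 0} := by
  obtain ⟨A, hA⟩ := Int.eq_ofNat_of_zero_le (sum_nonneg fun j _ => abs_nonneg (a j) :
    0 ≤ ∑ j, |a j|)
  set B := (A + 1) ^ 2 with hB
  have hB0 : 0 < B := by positivity
  obtain ⟨C, hC⟩ := exists_nat_ge ((k : ℝ) ^ 2 * (2 * B) ^ (k - 2) / ε)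
  refine ⟨B * (C + 1), fun n hn => ?_⟩
  have hquot : C + 1 ≤ n / B := (Nat.le_div_iff_mul_le hB0).2 (by linarith)
  obtain ⟨s, hs⟩ : ∃ s, n / B = s + 1 := ⟨n / B - 1, by omega⟩
  have hlow : B * (s + 1) ≤ n := hs ▸ Nat.mul_div_le n B
  have hup : n ≤ 2 * B * (s + 1) := by
    have := Nat.lt_mul_div_succ n hB0
    rw [hs] at this
    nlinarith
  have hT := pow_le_card_solutions a hp hq (n := n) (s := s) (by
    rw [hA]
    exact_mod_cast hlow)
  have hD := card_noninjective_solutions_le hk a ha n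
  have hCs : (C : ℝ) ≤ (s + 1 : ℕ) := by exact_mod_cast (by omega : C ≤ s + 1)
  rw [div_le_iff₀ hε] at hC
  calc _ ≤ ((k ^ 2 * n ^ (k - 2) : ℕ) : ℝ) := by exact_mod_cast hD
    _ ≤ ((k ^ 2 * (2 * B * (s + 1)) ^ (k - 2) : ℕ) : ℝ) := by
        exact_mod_cast Nat.mul_le_mul_left _ (Nat.pow_le_pow_left hup _)
    _ = (k : ℝ) ^ 2 * (2 * B) ^ (k - 2) * ((s + 1 : ℕ) : ℝ) ^ (k - 2) := by
        push_cast
        rw [mul_pow]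
        ring
    _ ≤ ((s + 1 : ℕ) : ℝ) * ε * ((s + 1 : ℕ) : ℝ) ^ (k - 2) := by
        refine mul_le_mul_of_nonneg_right (hC.trans ?_) (by positivity)
        gcongr
    _ = ε * (((s + 1) ^ (k - 1) : ℕ) : ℝ) := by
        rw [show k - 1 = k - 2 + 1 by omega]
        push_cast
        ring
    _ ≤ _ := by
        gcongr


/-- If a linear equation with `k ≥ 3` terms and nonzero integer coefficients is
`2`-uncommon over the integers, then it is `r`-uncommon over the integers for every
`r ≥ 3`. -/
theorem two_uncommon_implies_r_uncommon
    (k : ℕ) (hk : 3 ≤ k) (a : Fin k → ℤ) (ha : ∀ i, a i ≠ 0)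
    (h2 : ∃ δ : ℝ, 0 < δ ∧ ∃ N₀ : ℕ, ∀ n : ℕ, N₀ ≤ n →
      ∃ c : ℤ → Fin 2,
        (2 : ℝ) ^ (k - 1) *
          (((Fintype.piFinset fun _ : Fin k => Finset.Icc (1 : ℤ) n).filter
            (fun x => (∑ i, a i * x i = 0) ∧ ∀ i j, c (x i) = c (x j))).card : ℝ)
        ≤ (1 - δ) *
          (((Fintype.piFinset fun _ : Fin k => Finset.Icc (1 : ℤ) n).filter
            (fun x => ∑ i, a i * x i = 0)).card : ℝ))
    (r : ℕ) (hr : 3 ≤ r) :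
    ∃ δ' : ℝ, 0 < δ' ∧ ∃ N₁ : ℕ, ∀ n : ℕ, N₁ ≤ n →
      ∃ c : ℤ → Fin r,
        (r : ℝ) ^ (k - 1) *
          (((Fintype.piFinset fun _ : Fin k => Finset.Icc (1 : ℤ) n).filter
            (fun x => (∑ i, a i * x i = 0) ∧ ∀ i j, c (x i) = c (x j))).card : ℝ)
        ≤ (1 - δ') *
          (((Fintype.piFinset fun _ : Fin k => Finset.Icc (1 : ℤ) n).filter
            (fun x => ∑ i, a i * x i = 0)).card : ℝ) := by
  have : NeZero k := ⟨by omega⟩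
  by_cases hsign : (∃ p, 0 < a p) ∧ ∃ q, a q < 0
  swap
  · refine ⟨1, one_pos, 0, fun n _ => ⟨fun _ => ⟨0, by omega⟩, ?_⟩⟩
    rw [← Finset.filter_filter, solutions_eq_empty (by omega) a ha hsign n]
    simp
  obtain ⟨⟨p, hp⟩, q, hq⟩ := hsign
  obtain ⟨δ, hδ, N₀, h2⟩ := h2
  obtain ⟨m, rfl⟩ : ∃ m, r = m + 2 := ⟨r - 2, by omega⟩
  have hR : (0 : ℝ) < (m : ℝ) + 2 := by positivity
  obtain ⟨N, hN⟩ := exists_forall_card_noninjective_le hk a ha hp hq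
    (ε := δ / ((m : ℝ) + 2) ^ k) (by positivity)
  refine ⟨δ / ((m : ℝ) + 2), by positivity, max N₀ N, fun n hn => ?_⟩
  obtain ⟨c, hc⟩ := h2 n ((le_max_left _ _).trans hn)
  have hD := hN n ((le_max_right _ _).trans hn)
  obtain ⟨c', hc'⟩ := exists_coloring_card_mono_le m (Finset.Icc (1 : ℤ) n)
    ((Fintype.piFinset fun _ : Fin k => Finset.Icc (1 : ℤ) n).filter
      (fun x => ∑ i, a i * x i = 0))
    (fun x hx => Fintype.mem_piFinset.1 (Finset.mem_filter.1 hx).1) c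
  refine ⟨c', ?_⟩
  rw [← Finset.filter_filter] at hc ⊢
  have hc'' := (Nat.cast_le (α := ℝ)).2 hc'
  push_cast at hc'' ⊢
  rw [div_mul_eq_mul_div, le_div_iff₀ (by positivity)] at hD
  obtain ⟨l, rfl⟩ : ∃ l, k = l + 1 := ⟨k - 1, by omega⟩
  rw [Nat.add_sub_cancel] at hc ⊢
  rw [one_sub_div hR.ne', div_mul_eq_mul_div, le_div_iff₀ hR]
  rw [pow_succ (2 : ℝ) l] at hc''
  rw [pow_succ ((m : ℝ) + 2) l] at hc'' hD
  linarith
end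

section
/- Let k ≥ 3, let a_1, …, a_k be nonzero integers, and let r ≥ 3. If the equation E : a_1x_1 + ⋯ + a_kx_k = 0 is (r−1)-uncommon over the integers (there exist δ > 0 and N₀ such that for every n ≥ N₀ there is a coloring c : {1,…,n} → {1,…,r−1} with (r−1)^{k−1} · #{monochromatic solutions of E in {1,…,n}^k} ≤ (1 − δ) · #{solutions of E in {1,…,n}^k}), then E is r-uncommon over the integers (there exist δ' > 0 and N₁ such that for every n ≥ N₁ there is a coloring c : {1,…,n} → {1,…,r} with r^{k−1} · #{monochromatic solutions of E in {1,…,n}^k} ≤ (1 − δ') · #{solutions of E in {1,…,n}^k}). -/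
open Finset in
/-- The proportion of maps `α → β` sending `U` into `A` is `(#A / #β) ^ #U`. -/
theorem card_filter_maps_mul_pow {α β : Type*} [Fintype α] [Fintype β] [DecidableEq α]
    [DecidableEq β] (U : Finset α) (A : Finset β) :
    (univ.filter fun g : α → β => ∀ u ∈ U, g u ∈ A).card * Fintype.card β ^ U.card =
      A.card ^ U.card * Fintype.card β ^ Fintype.card α := by
  have h : (univ.filter fun g : α → β => ∀ u ∈ U, g u ∈ A) =
      Fintype.piFinset fun u => if u ∈ U then A else univ := by
    ext g
    simp only [mem_filter, mem_univ, true_and, Fintype.mem_piFinset]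
    refine forall_congr' fun u => ?_
    split_ifs with hu <;> simp [hu]
  have hcard : ∀ u, (if u ∈ U then A else univ).card =
      if u ∈ U then A.card else Fintype.card β := fun u => by
    split_ifs <;> simp
  rw [h, Fintype.card_piFinset, Finset.prod_congr rfl fun u _ => hcard u, Finset.prod_ite,
    prod_const, prod_const, filter_not, filter_mem_eq_inter, univ_inter, mul_assoc, ← pow_add,
    card_sdiff_of_subset (subset_univ U), card_univ, Nat.sub_add_cancel (card_le_univ U)]

open Finset in
/-- Recoloring each point of `W` with a new color, independently with probability `1 / (q + 1)`,
produces few monochromatic tuples on average. -/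
theorem exists_coloring_succ {V : Type*} [DecidableEq V] {k q : ℕ} (W : Finset V)
    (F : Finset (Fin k → V)) (hF : ∀ x ∈ F, ∀ i, x i ∈ W) (c : V → Fin q) (hk : 0 < k) :
    ∃ d : V → Fin (q + 1),
      (q + 1) ^ k * (F.filter fun x => ∀ i j, d (x i) = d (x j)).card ≤
        F.card + q ^ k * (F.filter fun x => ∀ i j, c (x i) = c (x j)).card +
          (q + 1) ^ k * (F.filter fun x => ¬ Function.Injective x).card := by
  classical
  let d : (W → Fin (q + 1)) → V → Fin (q + 1) := fun g v =>
    if h : v ∈ W then if g ⟨v, h⟩ = 0 then Fin.last q else (c v).castSucc else Fin.last q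
  have hcount : ∀ x ∈ F,
      (q + 1) ^ k * (univ.filter fun g => ∀ i j, d g (x i) = d g (x j)).card ≤
        (q + 1) ^ Fintype.card W * (1 + q ^ k * (if ∀ i j, c (x i) = c (x j) then 1 else 0) +
          (q + 1) ^ k * (if ¬ Function.Injective x then 1 else 0)) := by
    intro x hx
    by_cases hinj : Function.Injective x
    · let y : Fin k → W := fun i => ⟨x i, hF x hx i⟩
      have hy : Function.Injective y := fun i j h => hinj (congrArg Subtype.val h)
      let U : Finset W := univ.image y
      have hU : U.card = k := by simp [U, card_image_of_injective _ hy]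
      have hzero := card_filter_maps_mul_pow U ({0} : Finset (Fin (q + 1)))
      have hne := card_filter_maps_mul_pow U ({0}ᶜ : Finset (Fin (q + 1)))
      have hd : ∀ g i, d g (x i) = if g (y i) = 0 then Fin.last q else (c (x i)).castSucc :=
        fun g i => by simp [d, y, hF x hx i]
      simp only [card_compl, card_singleton, Fintype.card_fin, hU, Nat.add_sub_cancel,
        one_pow, one_mul] at hzero hne
      have hdich : ∀ g, (∀ i j, d g (x i) = d g (x j)) →
          (∀ u ∈ U, g u ∈ ({0} : Finset _)) ∨
            ((∀ u ∈ U, g u ∈ ({0}ᶜ : Finset _)) ∧ ∀ i j, c (x i) = c (x j)) := by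
        intro g hg
        by_cases h0 : g (y ⟨0, hk⟩) = 0
        · left
          simp only [U, mem_image, mem_univ, true_and, forall_exists_index,
            forall_apply_eq_imp_iff, mem_singleton]
          intro i
          have := hg i ⟨0, hk⟩
          rw [hd, hd, if_pos h0] at this
          by_contra hi
          rw [if_neg hi] at this
          exact (Fin.castSucc_lt_last _).ne this
        · right
          have hall : ∀ i, g (y i) ≠ 0 := by
            intro i hi
            have := hg i ⟨0, hk⟩
            rw [hd, hd, if_neg h0, if_pos hi] at this
            exact (Fin.castSucc_lt_last _).ne this.symm
          refine ⟨by simpa [U] using fun i => hall i, fun i j => ?_⟩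
          have := hg i j
          rw [hd, hd, if_neg (hall i), if_neg (hall j)] at this
          exact Fin.castSucc_injective _ this
      by_cases hc : ∀ i j, c (x i) = c (x j)
      · have hle := (card_le_card (s := univ.filter fun g => ∀ i j, d g (x i) = d g (x j))
          (t := (univ.filter fun g : W → Fin (q + 1) => ∀ u ∈ U, g u ∈ ({0} : Finset _)) ∪
            univ.filter fun g : W → Fin (q + 1) => ∀ u ∈ U, g u ∈ ({0}ᶜ : Finset (Fin (q + 1))))
            (fun g hg => by
              rw [← filter_or]
              exact mem_filter.2 ⟨mem_univ _, (hdich g (mem_filter.1 hg).2).imp_right And.left⟩)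
              ).trans (card_union_le _ _)
        rw [if_pos hc, if_neg (not_not.2 hinj)]
        calc _ ≤ _ := Nat.mul_le_mul_left _ hle
          _ = _ := by rw [mul_comm, add_mul, hzero, hne]; ring
      · have hle := card_le_card (t := univ.filter fun g => ∀ u ∈ U, g u ∈ ({0} : Finset _))
            (s := univ.filter fun g => ∀ i j, d g (x i) = d g (x j))
            (fun g hg => mem_filter.2 ⟨mem_univ _,
              (hdich g (mem_filter.1 hg).2).resolve_right fun h => hc h.2⟩)
        rw [if_neg hc, if_neg (not_not.2 hinj)]
        calc _ ≤ _ := Nat.mul_le_mul_left _ hle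
          _ = _ := by rw [mul_comm, hzero]; ring
    · have hle := card_le_univ (univ.filter fun g => ∀ i j, d g (x i) = d g (x j))
      rw [Fintype.card_fun, Fintype.card_fin] at hle
      rw [if_pos hinj]
      calc _ ≤ _ := Nat.mul_le_mul_left _ hle
        _ = (q + 1) ^ Fintype.card W * ((q + 1) ^ k * 1) := by ring
        _ ≤ _ := Nat.mul_le_mul_left _ (Nat.le_add_left _ _)
  by_contra! hcon
  have hsum : ∑ g, (q + 1) ^ k * (F.filter fun x => ∀ i j, d g (x i) = d g (x j)).card =
      ∑ x ∈ F, (q + 1) ^ k * (univ.filter fun g => ∀ i j, d g (x i) = d g (x j)).card := by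
    simp only [card_filter, ← mul_sum]
    rw [sum_comm]
  have hlt := sum_lt_sum_of_nonempty (univ_nonempty (α := W → Fin (q + 1)))
    fun g _ => hcon (d g)
  rw [hsum] at hlt
  have hlt' := hlt.trans_le (sum_le_sum hcount)
  rw [sum_const, card_univ, Fintype.card_fun, Fintype.card_fin, smul_eq_mul, ← mul_sum,
    sum_add_distrib, sum_add_distrib, ← mul_sum, ← mul_sum, ← card_filter, ← card_filter,
    sum_const, smul_eq_mul, mul_one] at hlt'
  exact lt_irrefl _ hlt'

open Finset in
/-- A linear equation with nonzero coefficients in `k ≥ 3` variables has `O(n ^ (k - 2))`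
solutions with a repeated coordinate. -/
theorem card_not_injective_solutions_le {k : ℕ} (hk : 3 ≤ k) (a : Fin k → ℤ)
    (ha : ∀ i, a i ≠ 0) (n : ℕ) :
    ((Fintype.piFinset fun _ : Fin k => Icc (1 : ℤ) n).filter
      (fun x => (∑ i, a i * x i = 0) ∧ ¬ Function.Injective x)).card ≤ k ^ 2 * n ^ (k - 2) := by
  classical
  let B : Fin k × Fin k → Finset (Fin k → ℤ) := fun p =>
    (Fintype.piFinset fun _ : Fin k => Icc (1 : ℤ) n).filter
      (fun x => (∑ i, a i * x i = 0) ∧ p.1 ≠ p.2 ∧ x p.1 = x p.2)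
  have hB : ∀ p ∈ (univ : Finset (Fin k × Fin k)), (B p).card ≤ n ^ (k - 2) := by
    rintro ⟨i, j⟩ -
    by_cases hij : i = j
    · simp [B, hij]
    obtain ⟨l, hl⟩ : ∃ l, l ∉ ({i, j} : Finset (Fin k)) := by
      by_contra! h
      have h1 := card_le_card (fun l _ => h l : univ ⊆ ({i, j} : Finset (Fin k)))
      have h2 := card_le_two (a := i) (b := j)
      rw [card_univ, Fintype.card_fin] at h1
      omega
    simp only [mem_insert, mem_singleton, not_or] at hl
    have hcard : Fintype.card ↥({i, l}ᶜ : Finset (Fin k)) = k - 2 := by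
      rw [Fintype.card_coe, card_compl, card_pair (Ne.symm hl.1), Fintype.card_fin]
    let T := Fintype.piFinset fun _ : ↥({i, l}ᶜ : Finset (Fin k)) => Icc (1 : ℤ) n
    have hT : T.card = n ^ (k - 2) := by
      simp only [T, Fintype.card_piFinset, prod_const, card_univ, hcard, Int.card_Icc]
      simp
    rw [← hT]
    refine card_le_card_of_injOn (fun x u => x u) ?_ ?_
    · intro x hx
      simp only [B, coe_filter, Set.mem_ofPred_eq, Fintype.mem_piFinset] at hx
      simp only [T, mem_coe, Fintype.mem_piFinset]
      exact fun u => hx.1 u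
    · intro x hx y hy hxy
      simp only [B, coe_filter, Set.mem_ofPred_eq] at hx hy
      have hoff : ∀ u, u ≠ i → u ≠ l → x u = y u := fun u hui hul =>
        congrFun hxy ⟨u, by simp [hui, hul]⟩
      have hi : x i = y i := by
        rw [hx.2.2.2, hy.2.2.2]
        exact hoff j (Ne.symm hij) (Ne.symm hl.2)
      have hne : ∀ u, u ≠ l → x u = y u := fun u hul => by
        by_cases hui : u = i
        · rw [hui, hi]
        · exact hoff u hui hul
      have hsum := hx.2.1.trans hy.2.1.symm
      rw [← add_sum_erase _ _ (mem_univ l), ← add_sum_erase _ _ (mem_univ l),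
        sum_congr rfl fun u hu => by rw [hne u (ne_of_mem_erase hu)]] at hsum
      have hxl : x l = y l := mul_left_cancel₀ (ha l) (add_right_cancel hsum)
      funext u
      by_cases hul : u = l
      · rw [hul, hxl]
      · exact hne u hul
  have hsub : ((Fintype.piFinset fun _ : Fin k => Icc (1 : ℤ) n).filter
      (fun x => (∑ i, a i * x i = 0) ∧ ¬ Function.Injective x)) ⊆ univ.biUnion B := by
    intro x hx
    simp only [mem_filter, Function.Injective, not_forall] at hx
    obtain ⟨hmem, hsol, i, j, hij, hne⟩ := hx
    exact mem_biUnion.2 ⟨(i, j), mem_univ _, mem_filter.2 ⟨hmem, hsol, hne, hij⟩⟩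
  calc _ ≤ _ := card_le_card hsub
    _ ≤ _ := card_biUnion_le_card_mul _ _ _ hB
    _ = _ := by simp [sq]

open Finset in
/-- A linear equation with coefficients of both signs has a solution in positive integers bounded
by the sum of the absolute values of the coefficients. -/
theorem exists_pos_solution {k : ℕ} (a : Fin k → ℤ) (hpos : ∃ i, 0 < a i)
    (hneg : ∃ i, a i < 0) :
    ∃ p : Fin k → ℤ, (∑ i, a i * p i = 0) ∧ ∀ i, 1 ≤ p i ∧ p i ≤ ∑ j, |a j| := by
  obtain ⟨i, hi⟩ := hpos
  obtain ⟨j, hj⟩ := hneg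
  have hP : 1 ≤ ∑ i, max (a i) 0 :=
    le_trans (by omega) (single_le_sum (f := fun i => max (a i) 0)
      (fun i _ => le_max_right _ _) (mem_univ i))
  have hN : 1 ≤ ∑ i, max (-a i) 0 :=
    le_trans (by omega) (single_le_sum (f := fun i => max (-a i) 0)
      (fun i _ => le_max_right _ _) (mem_univ j))
  have hPS : ∑ i, max (a i) 0 ≤ ∑ j, |a j| :=
    sum_le_sum fun i _ => max_le (le_abs_self _) (abs_nonneg _)
  have hNS : ∑ i, max (-a i) 0 ≤ ∑ j, |a j| :=
    sum_le_sum fun i _ => max_le (neg_le_abs _) (abs_nonneg _)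
  refine ⟨fun l => if 0 < a l then ∑ i, max (-a i) 0 else ∑ i, max (a i) 0, ?_, fun l => ?_⟩
  · have : ∀ l, a l * (if 0 < a l then ∑ i, max (-a i) 0 else ∑ i, max (a i) 0) =
        max (a l) 0 * ∑ i, max (-a i) 0 - max (-a l) 0 * ∑ i, max (a i) 0 := by
      intro l
      split_ifs with h
      · rw [max_eq_left h.le, max_eq_right (by omega : -a l ≤ 0)]; ring
      · rw [max_eq_right (not_lt.1 h), max_eq_left (by omega : 0 ≤ -a l)]; ring
    rw [sum_congr rfl fun l _ => this l, sum_sub_distrib, ← sum_mul, ← sum_mul]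
    ring
  · dsimp only
    split_ifs
    · exact ⟨hN, hNS⟩
    · exact ⟨hP, hPS⟩

open Finset in
/-- A linear equation with coefficients of both signs has `Ω(n ^ (k - 1))` solutions. -/
theorem exists_pow_le_mul_card_solutions {k : ℕ} (hk : 0 < k) (a : Fin k → ℤ)
    (hpos : ∃ i, 0 < a i) (hneg : ∃ i, a i < 0) :
    ∃ K N₀ : ℕ, ∀ n : ℕ, N₀ ≤ n → n ^ (k - 1) ≤
      K * ((Fintype.piFinset fun _ : Fin k => Icc (1 : ℤ) n).filter
        (fun x => ∑ i, a i * x i = 0)).card := by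
  classical
  obtain ⟨p, hp, hpb⟩ := exists_pos_solution a hpos hneg
  obtain ⟨S, hS⟩ : ∃ S : ℕ, (S : ℤ) = ∑ j, |a j| :=
    ⟨_, Int.toNat_of_nonneg (sum_nonneg fun _ _ => abs_nonneg _)⟩
  have hS1 : 1 ≤ S := by
    have := hpb ⟨0, hk⟩
    omega
  rw [← hS] at hpb
  refine ⟨(2 * (S + 1)) ^ (k - 1) * (3 * S), S + 1, fun n hn => ?_⟩
  set T := (Fintype.piFinset fun _ : Fin k => Icc (1 : ℤ) n).filter
    (fun x => ∑ i, a i * x i = 0) with hT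
  let N := n / (S + 1)
  have hN1 : 1 ≤ N := (Nat.one_le_div_iff (by omega)).2 hn
  have hNn : N * (S + 1) ≤ n := Nat.div_mul_le_self _ _
  have hnN : n ≤ 2 * (S + 1) * N := by
    have h := Nat.lt_div_mul_add (a := n) (Nat.succ_pos S)
    change n < N * (S + 1) + (S + 1) at h
    nlinarith
  let Y := Fintype.piFinset fun _ : Fin k => Icc (1 : ℤ) N
  have hY : Y.card = N ^ k := by simp [Y]
  have hmaps : ∀ y ∈ Y, ∑ i, a i * y i ∈ Icc (-(S * N : ℤ)) (S * N) := by
    intro y hy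
    rw [Fintype.mem_piFinset] at hy
    rw [mem_Icc, ← abs_le, hS, sum_mul]
    refine (abs_sum_le_sum_abs _ _).trans (sum_le_sum fun i _ => ?_)
    have := mem_Icc.1 (hy i)
    rw [abs_mul]
    exact mul_le_mul_of_nonneg_left (abs_le.2 ⟨by omega, by omega⟩) (abs_nonneg _)
  have hfib : ∀ b ∈ Icc (-(S * N : ℤ)) (S * N),
      (Y.filter fun y => ∑ i, a i * y i = b).card ≤ T.card := by
    intro b _
    rcases (Y.filter fun y => ∑ i, a i * y i = b).eq_empty_or_nonempty with h | ⟨z, hz⟩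
    · rw [h]; simp
    refine card_le_card_of_injOn (fun y i => N * p i + (y i - z i)) ?_ ?_
    · intro y hy
      simp only [mem_coe, mem_filter, Y, Fintype.mem_piFinset, mem_Icc] at hy hz
      simp only [mem_coe, hT, mem_filter, Fintype.mem_piFinset, mem_Icc]
      refine ⟨fun i => ?_, ?_⟩
      · have h1 := hy.1 i
        have h2 := hz.1 i
        have h3 := hpb i
        have h4 : (N : ℤ) * (S + 1) ≤ n := by exact_mod_cast hNn
        constructor <;> nlinarith
      · have : ∀ i, a i * (N * p i + (y i - z i)) =
            N * (a i * p i) + (a i * y i - a i * z i) := fun i => by ring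
        rw [sum_congr rfl fun i _ => this i, sum_add_distrib, sum_sub_distrib, ← mul_sum, hp,
          hy.2, hz.2]
        ring
    · intro y _ y' _ h
      funext i
      have := congrFun h i
      dsimp only at this
      omega
  have hle := card_le_mul_card_image_of_maps_to hmaps _ hfib
  have hIcc : (Icc (-(S * N : ℤ)) (S * N)).card ≤ 3 * S * N := by
    rw [Int.card_Icc]
    have : (1 : ℤ) ≤ S * N := by exact_mod_cast Nat.mul_pos hS1 hN1
    have h2 : ((3 * S * N : ℕ) : ℤ) = 3 * (S * N) := by push_cast; ring
    omega
  have hpow : N ^ (k - 1) ≤ 3 * S * T.card := by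
    refine Nat.le_of_mul_le_mul_right ?_ hN1
    calc N ^ (k - 1) * N = Y.card := by rw [hY, ← pow_succ, Nat.sub_add_cancel hk]
      _ ≤ _ := hle.trans (Nat.mul_le_mul_left _ hIcc)
      _ = _ := by ring
  calc n ^ (k - 1) ≤ (2 * (S + 1) * N) ^ (k - 1) := Nat.pow_le_pow_left hnN _
    _ = (2 * (S + 1)) ^ (k - 1) * N ^ (k - 1) := mul_pow _ _ _
    _ ≤ (2 * (S + 1)) ^ (k - 1) * (3 * S * T.card) := Nat.mul_le_mul_left _ hpow
    _ = _ := by ring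

open Finset in
/-- An equation whose nonzero coefficients all have the same sign has no positive solutions. -/
theorem exists_pos_and_exists_neg_of_solution {k : ℕ} (hk : 0 < k) {a x : Fin k → ℤ}
    (ha : ∀ i, a i ≠ 0) (hx : ∀ i, 0 < x i) (h : ∑ i, a i * x i = 0) :
    (∃ i, 0 < a i) ∧ ∃ i, a i < 0 := by
  have hne : (univ : Finset (Fin k)).Nonempty := ⟨⟨0, hk⟩, mem_univ _⟩
  constructor
  · by_contra! hcon
    exact (sum_neg (fun i _ => mul_neg_of_neg_of_pos ((hcon i).lt_of_ne (ha i)) (hx i)) hne).ne h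
  · by_contra! hcon
    exact (sum_pos (fun i _ => mul_pos ((hcon i).lt_of_ne (ha i).symm) (hx i)) hne).ne' h

/-- For `k ≥ 3` and `r ≥ 3`: if a linear equation with nonzero integer coefficients is
`(r-1)`-uncommon over the integers, then it is `r`-uncommon over the integers. -/
theorem r_sub_one_uncommon_implies_r_uncommon
    (k : ℕ) (hk : 3 ≤ k) (a : Fin k → ℤ) (ha : ∀ i, a i ≠ 0)
    (r : ℕ) (hr : 3 ≤ r)
    (hprev : ∃ δ : ℝ, 0 < δ ∧ ∃ N₀ : ℕ, ∀ n : ℕ, N₀ ≤ n →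
      ∃ c : ℤ → Fin (r - 1),
        ((r : ℝ) - 1) ^ (k - 1) *
          (((Fintype.piFinset fun _ : Fin k => Finset.Icc (1 : ℤ) n).filter
            (fun x => (∑ i, a i * x i = 0) ∧ ∀ i j, c (x i) = c (x j))).card : ℝ)
        ≤ (1 - δ) *
          (((Fintype.piFinset fun _ : Fin k => Finset.Icc (1 : ℤ) n).filter
            (fun x => ∑ i, a i * x i = 0)).card : ℝ)) :
    ∃ δ' : ℝ, 0 < δ' ∧ ∃ N₁ : ℕ, ∀ n : ℕ, N₁ ≤ n →
      ∃ c : ℤ → Fin r,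
        (r : ℝ) ^ (k - 1) *
          (((Fintype.piFinset fun _ : Fin k => Finset.Icc (1 : ℤ) n).filter
            (fun x => (∑ i, a i * x i = 0) ∧ ∀ i j, c (x i) = c (x j))).card : ℝ)
        ≤ (1 - δ') *
          (((Fintype.piFinset fun _ : Fin k => Finset.Icc (1 : ℤ) n).filter
            (fun x => ∑ i, a i * x i = 0)).card : ℝ) := by
  obtain ⟨q, rfl⟩ : ∃ q, r = q + 1 := ⟨r - 1, by omega⟩
  obtain ⟨δ, hδ, N₀, hN⟩ := hprev
  by_cases hsign : (∃ i, 0 < a i) ∧ ∃ i, a i < 0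
  swap
  · refine ⟨1, one_pos, 0, fun n _ => ⟨fun _ => 0, ?_⟩⟩
    rw [Finset.filter_eq_empty_iff.2]
    · simp
    · intro x hx h
      refine hsign (exists_pos_and_exists_neg_of_solution (by omega) ha (fun i => ?_) h.1)
      exact (Finset.mem_Icc.1 (Fintype.mem_piFinset.1 hx i)).1
  obtain ⟨K, N₁, hK⟩ := exists_pow_le_mul_card_solutions (by omega) a hsign.1 hsign.2
  have hq : (0 : ℝ) < q := by exact_mod_cast (by omega : 0 < q)
  obtain ⟨N₂, hN₂⟩ := exists_nat_ge (2 * ((q : ℝ) + 1) ^ k * (k ^ 2 * K) / (q * δ))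
  refine ⟨q * δ / (2 * (q + 1)), by positivity, N₀ + N₁ + N₂ + 1, fun n hn => ?_⟩
  obtain ⟨c, hc⟩ := hN n (by omega)
  have hlow := hK n (by omega)
  have hdeg := card_not_injective_solutions_le hk a ha n
  simp only [← Finset.filter_filter] at hc hdeg ⊢
  set F := (Fintype.piFinset fun _ : Fin k => Finset.Icc (1 : ℤ) n).filter
    (fun x => ∑ i, a i * x i = 0)
  obtain ⟨d, hd⟩ := exists_coloring_succ (q := q) (Finset.Icc (1 : ℤ) n) F
    (fun x hx => Fintype.mem_piFinset.1 (Finset.mem_filter.1 hx).1) c (by omega)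
  refine ⟨d, ?_⟩
  rw [Nat.cast_add_one, add_sub_cancel_right] at hc
  set T := F.card
  set D := (F.filter fun x => ¬ Function.Injective x).card
  set M := (F.filter fun x => ∀ i j, d (x i) = d (x j)).card
  set C := (F.filter fun x => ∀ i j, c (x i) = c (x j)).card
  have hnD : n * D ≤ k ^ 2 * K * T := by
    calc n * D ≤ n * (k ^ 2 * n ^ (k - 2)) := Nat.mul_le_mul_left _ hdeg
      _ = k ^ 2 * n ^ (k - 2 + 1) := by ring
      _ = k ^ 2 * n ^ (k - 1) := by rw [show k - 2 + 1 = k - 1 by omega]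
      _ ≤ k ^ 2 * (K * T) := Nat.mul_le_mul_left _ hlow
      _ = _ := by ring
  have hnD' : (n : ℝ) * D ≤ k ^ 2 * K * T := by exact_mod_cast hnD
  have hd' : ((q : ℝ) + 1) ^ k * M ≤ T + (q : ℝ) ^ k * C + ((q : ℝ) + 1) ^ k * D := by
    exact_mod_cast hd
  have hn0 : (0 : ℝ) < n := by exact_mod_cast (by omega : 0 < n)
  have hnN₂ : (N₂ : ℝ) ≤ n := by exact_mod_cast (by omega : N₂ ≤ n)
  have hn' : 2 * ((q : ℝ) + 1) ^ k * (k ^ 2 * K) ≤ n * (q * δ) :=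
    (div_le_iff₀ (by positivity)).1 (hN₂.trans hnN₂)
  have hD : 2 * ((q : ℝ) + 1) ^ k * D ≤ q * δ * T := by
    refine le_of_mul_le_mul_left ?_ hn0
    calc (n : ℝ) * (2 * ((q : ℝ) + 1) ^ k * D) = 2 * ((q : ℝ) + 1) ^ k * (n * D) := by ring
      _ ≤ 2 * ((q : ℝ) + 1) ^ k * (k ^ 2 * K * T) := by gcongr
      _ = 2 * ((q : ℝ) + 1) ^ k * (k ^ 2 * K) * T := by ring
      _ ≤ n * (q * δ) * T := by gcongr
      _ = _ := by ring
  have hpk : ∀ z : ℝ, z ^ k = z * z ^ (k - 1) := fun z => by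
    rw [← pow_succ', Nat.sub_add_cancel (by omega)]
  have hC : (q : ℝ) ^ k * C ≤ q * ((1 - δ) * T) := by
    rw [hpk, mul_assoc]
    refine mul_le_mul_of_nonneg_left ?_ hq.le
    exact hc
  push_cast
  refine le_of_mul_le_mul_left ?_ (by positivity : (0 : ℝ) < q + 1)
  rw [← mul_assoc, ← hpk]
  have hδ' : ((q : ℝ) + 1) * ((1 - q * δ / (2 * (q + 1))) * T) =
      T + q * ((1 - δ) * T) + q * δ * T / 2 := by
    field_simp
    ring
  rw [hδ']
  linarith
end
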